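/- arXiv:math/0201227 — 3 statements merged into one kernel-verified Lean document; each statement's English description precedes it below -/
import Mathlib

section
/- For every R > 0 and every q with 1 < q < 2 there exist constants b₆, b₇ > 0, independent of z, such that for every z ∈ ℂ with z ∉ [−2,2] and d(z) ≤ R, and every integer k ≥ b₇/d(z)^q, the k×k matrix T_k(β) with entries (T_k(β))_{j,l} = β̂(j−l) (namely 2+z² on the diagonal, −2z on the first off-diagonals, 1 on the second off-diagonals, and 0 elsewhere) is invertible and satisfies ‖T_k(β)^{−1}‖ ≤ b₆/d(z)^8 (operator norm on ℂ^k with the standard Hermitian norm). -/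
noncomputable section

/-- Fourier coefficients of the symbol `β(e^{iθ};z) = (2cosθ − z)²`. -/
def bhat (z : ℂ) (n : ℤ) : ℂ :=
  if n = 0 then 2 + z ^ 2 else if n.natAbs = 1 then -2 * z else if n.natAbs = 2 then 1 else 0

/-- The interval [−2,2] regarded as a subset of ℂ. -/
def I22 : Set ℂ := (fun x : ℝ => (x : ℂ)) '' Set.Icc (-2) 2

/-- The k×k Toeplitz matrix `T_k(β)`: `2+z²` on the diagonal, `−2z` on the first
off-diagonals, `1` on the second off-diagonals, `0` elsewhere. -/
def Tbeta (z : ℂ) (k : ℕ) : Matrix (Fin k) (Fin k) ℂ :=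
  Matrix.of fun j l : Fin k => bhat z ((j : ℤ) - (l : ℤ))

namespace Stmt5

open Complex Finset

/-- restriction of a sequence on `ℤ` to a vector in `ℂ^k` -/
def E (k : ℕ) (F : ℤ → ℂ) : EuclideanSpace ℂ (Fin k) := WithLp.toLp 2 (fun j => F (j : ℤ))

def M (z : ℂ) (X : ℤ → ℂ) : ℤ → ℂ := fun j => X (j - 1) + X (j + 1) - z * X j

def L (z : ℂ) (X : ℤ → ℂ) : ℤ → ℂ := fun j =>
  X (j - 2) - 2 * z * X (j - 1) + (2 + z ^ 2) * X j - 2 * z * X (j + 1) + X (j + 2)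

def Supp (k : ℕ) (X : ℤ → ℂ) : Prop := ∀ n : ℤ, (n < 0 ∨ (k : ℤ) ≤ n) → X n = 0

lemma norm_sq_E (k : ℕ) (X : ℤ → ℂ) : ‖E k X‖ ^ 2 = ∑ j ∈ range k, ‖X j‖ ^ 2 := by
  rw [EuclideanSpace.norm_sq_eq, ← Fin.sum_univ_eq_sum_range (fun j => ‖X (j : ℤ)‖ ^ 2)]
  rfl

lemma coord_le (k : ℕ) (X : ℤ → ℂ) (j : ℕ) (hj : j < k) : ‖X j‖ ≤ ‖E k X‖ :=
  PiLp.norm_apply_le (E k X) (⟨j, hj⟩ : Fin k)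

lemma coord_le' (k : ℕ) (X : ℤ → ℂ) (hX : Supp k X) (n : ℤ) : ‖X n‖ ≤ ‖E k X‖ := by
  by_cases h : n < 0 ∨ (k : ℤ) ≤ n
  · rw [hX n h]; simp
  · push Not at h
    obtain ⟨m, rfl⟩ := Int.eq_ofNat_of_zero_le h.1
    exact coord_le k X m (by have := h.2; omega)

lemma key1 (z : ℂ) (k : ℕ) (X : ℤ → ℂ) (hX : Supp k X) :
    Metric.infDist z I22 * ‖E k X‖ ≤ ‖E k (M z X)‖ := by
  set d := Metric.infDist z I22 with hd
  rcases eq_or_lt_of_le (norm_nonneg (E k X)) with h0 | h0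
  · rw [← h0]; simp
  set c : ℂ := ∑ j ∈ range k, (starRingEnd ℂ) (X j) * X (j + 1) with hc
  have h1 : ∑ j ∈ range k, (starRingEnd ℂ) (X j) * X (j - 1) = (starRingEnd ℂ) c := by
    rw [hc, map_sum, ← sub_eq_zero, ← Finset.sum_sub_distrib]
    have := Finset.sum_range_sub (fun j : ℕ => (starRingEnd ℂ) (X j) * X (j - 1)) k
    have e : ∀ j ∈ range k, (starRingEnd ℂ) (X j) * X (j - 1)
        - (starRingEnd ℂ) ((starRingEnd ℂ) (X j) * X (j + 1)) =
        - ((fun j : ℕ => (starRingEnd ℂ) (X j) * X (j - 1)) (j + 1)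
          - (fun j : ℕ => (starRingEnd ℂ) (X j) * X (j - 1)) j) := by
      intro j _
      simp
      ring
    rw [Finset.sum_congr rfl e, Finset.sum_neg_distrib, this]
    simp [hX (k : ℤ) (by simp), hX (-1) (by simp)]
  have hcn : ‖c‖ ≤ ‖E k X‖ ^ 2 := by
    have h2 : ∑ j ∈ range k, ‖X (j + 1)‖ ^ 2 ≤ ∑ j ∈ range k, ‖X j‖ ^ 2 := by
      have := Finset.sum_range_sub (fun j : ℕ => ‖X j‖ ^ 2) k
      rw [Finset.sum_sub_distrib] at this
      simp [hX (k : ℤ) (by simp)] at this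
      nlinarith [sq_nonneg ‖X 0‖]
    calc ‖c‖ ≤ ∑ j ∈ range k, ‖(starRingEnd ℂ) (X j) * X (j + 1)‖ := norm_sum_le _ _
      _ ≤ ∑ j ∈ range k, (‖X j‖ ^ 2 + ‖X (j + 1)‖ ^ 2) / 2 := by
        apply Finset.sum_le_sum
        intro j _
        rw [norm_mul, RCLike.norm_conj]
        nlinarith [sq_nonneg (‖X j‖ - ‖X (j + 1)‖)]
      _ ≤ ‖E k X‖ ^ 2 := by
        rw [← Finset.sum_div, Finset.sum_add_distrib, norm_sq_E]
        linarith
  have hin : inner ℂ (E k X) (E k (M z X)) = ((2 * c.re : ℝ) : ℂ) - z * ((‖E k X‖ ^ 2 : ℝ) : ℂ) := by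
    have : inner ℂ (E k X) (E k (M z X)) = ∑ j ∈ range k, (starRingEnd ℂ) (X j) * M z X j := by
      rw [← Fin.sum_univ_eq_sum_range (fun j => (starRingEnd ℂ) (X (j : ℤ)) * M z X (j : ℤ)),
        PiLp.inner_apply]
      simp [E, mul_comm]
    have e : ∀ j ∈ range k, (starRingEnd ℂ) (X j) * M z X j =
        (starRingEnd ℂ) (X j) * X (j - 1) + (starRingEnd ℂ) (X j) * X (j + 1)
          - z * ((‖X j‖ ^ 2 : ℝ) : ℂ) := by
      intro j _
      have := Complex.conj_mul' (X j)
      push_cast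
      rw [← this]
      simp only [M]; ring
    rw [this, Finset.sum_congr rfl e, Finset.sum_sub_distrib, Finset.sum_add_distrib, h1, ← hc,
      ← Finset.mul_sum, norm_sq_E, add_comm, Complex.add_conj]
    push_cast; rfl
  have hN : 0 < ‖E k X‖ ^ 2 := by positivity
  set t : ℝ := 2 * c.re / ‖E k X‖ ^ 2 with ht
  have hre := (Complex.abs_re_le_norm c).trans hcn
  have hre' := abs_le.1 hre
  have htm : (t : ℂ) ∈ I22 := by
    refine ⟨t, ⟨?_, ?_⟩, rfl⟩
    · rw [ht, le_div_iff₀ hN]; linarith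
    · rw [ht, div_le_iff₀ hN]; linarith
  have hdt : d ≤ ‖z - t‖ := by
    have := Metric.infDist_le_dist_of_mem (x := z) htm
    rwa [dist_eq_norm] at this
  have h3 : ‖inner ℂ (E k X) (E k (M z X))‖ = ‖z - t‖ * ‖E k X‖ ^ 2 := by
    have : inner ℂ (E k X) (E k (M z X)) = -((z - t) * ((‖E k X‖ ^ 2 : ℝ) : ℂ)) := by
      have h5 : (2 * c.re : ℝ) = t * ‖E k X‖ ^ 2 := by rw [ht]; field_simp
      rw [hin, h5]
      push_cast; ring
    rw [this, norm_neg, norm_mul, Complex.norm_real, Real.norm_of_nonneg hN.le]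
  have h4 := norm_inner_le_norm (𝕜 := ℂ) (E k X) (E k (M z X))
  rw [h3] at h4
  have h6 : d * ‖E k X‖ ^ 2 ≤ ‖z - t‖ * ‖E k X‖ ^ 2 := by gcongr
  have : (d * ‖E k X‖) * ‖E k X‖ ≤ ‖E k (M z X)‖ * ‖E k X‖ := by nlinarith
  exact le_of_mul_le_mul_right this h0

lemma key2 (z : ℂ) (k : ℕ) (hk : 1 ≤ k) (X : ℤ → ℂ) (hX : Supp k X) :
    Metric.infDist z I22 ^ 2 * ‖E k X‖ ≤ ‖E k (L z X)‖ + ‖X 0‖ + ‖X (k - 1)‖ := by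
  have hd : 0 ≤ Metric.infDist z I22 := Metric.infDist_nonneg
  set Y : ℤ → ℂ := fun n => if n < 0 ∨ (k : ℤ) ≤ n then 0 else M z X n with hY
  have hYs : Supp k Y := fun n hn => by simp only [hY]; rw [if_pos hn]
  have hEY : E k Y = E k (M z X) := by
    unfold E; congr 1; funext j
    simp only [hY]; rw [if_neg]; have := j.2; omega
  have a1 := key1 z k X hX
  have a2 := key1 z k Y hYs
  rw [hEY] at a2
  have hdec : E k (M z Y) = E k (L z X) - EuclideanSpace.single (⟨0, hk⟩ : Fin k) (X 0)
      - EuclideanSpace.single (⟨k - 1, by omega⟩ : Fin k) (X (k - 1)) := by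
    ext j
    have hj := j.2
    have b1 : Y (j - 1) = M z X (j - 1) - if (j : ℕ) = 0 then X 0 else 0 := by
      simp only [hY]
      split_ifs with h1 h2 h2
      · simp only [h2, M]; simp [hX (-1) (by simp), hX (-2) (by simp)]
      · omega
      · omega
      · simp
    have b2 : Y (j + 1) = M z X (j + 1) - if (j : ℕ) = k - 1 then X (k - 1) else 0 := by
      simp only [hY]
      split_ifs with h1 h2 h2
      · have e : ((j : ℕ) : ℤ) = k - 1 := by omega
        simp only [e, M]; simp [hX k (by simp), hX (k+1) (by omega)]
      · omega
      · omega
      · simp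
    have b3 : Y j = M z X j := by
      simp only [hY]; rw [if_neg]; omega
    have c1 : (j = (⟨0, hk⟩ : Fin k)) ↔ (j : ℕ) = 0 := Fin.ext_iff
    have c2 : (j = (⟨k - 1, by omega⟩ : Fin k)) ↔ (j : ℕ) = k - 1 := Fin.ext_iff
    simp only [E, PiLp.sub_apply, PiLp.single_apply, c1, c2]
    have : M z Y j = Y (j - 1) + Y (j + 1) - z * Y j := rfl
    rw [this, b1, b2, b3]
    have e1 : ((j : ℕ) : ℤ) - 1 - 1 = j - 2 := by ring
    have e2 : ((j : ℕ) : ℤ) + 1 + 1 = j + 2 := by ring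
    have e3 : ((j : ℕ) : ℤ) - 1 + 1 = j := by ring
    have e4 : ((j : ℕ) : ℤ) + 1 - 1 = j := by ring
    simp only [M, L, e1, e2, e3, e4]
    ring
  have h5 : ‖E k (M z Y)‖ ≤ ‖E k (L z X)‖ + ‖X 0‖ + ‖X (k - 1)‖ := by
    rw [hdec]
    refine (norm_sub_le _ _).trans ?_
    rw [PiLp.norm_single]
    gcongr
    refine (norm_sub_le _ _).trans ?_
    rw [PiLp.norm_single]
  nlinarith [mul_le_mul_of_nonneg_left a1 hd]

lemma sum_bound (r : ℝ) (h0 : 0 ≤ r) (h1 : r < 1) (k : ℕ) :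
    ∑ j ∈ range k, ((j : ℝ) + 1) * r ^ (j + 2) ≤ 1 / (1 - r) ^ 2 := by
  have h : (∑ j ∈ range k, ((j : ℝ) + 1) * r ^ j) * (1 - r) ^ 2
      = 1 - r ^ k * (1 + k * (1 - r)) := by
    induction k with
    | zero => simp
    | succ n ih => rw [Finset.sum_range_succ, add_mul, ih]; push_cast; ring
  have hp : 0 < (1 - r) ^ 2 := by have : 0 < 1 - r := by linarith
                                  positivity
  have h2 : ∑ j ∈ range k, ((j : ℝ) + 1) * r ^ (j + 2) ≤ ∑ j ∈ range k, ((j : ℝ) + 1) * r ^ j := by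
    apply Finset.sum_le_sum
    intro j _
    have : r ^ (j + 2) ≤ r ^ j := pow_le_pow_of_le_one h0 h1.le (by omega)
    gcongr
  refine h2.trans ?_
  rw [le_div_iff₀ hp, h]
  have : 0 ≤ r ^ k * (1 + k * (1 - r)) := by
    have : 0 ≤ 1 - r := by linarith
    positivity
  linarith

lemma key3 (z w : ℂ) (hw0 : w ≠ 0) (hw1 : ‖w‖ < 1) (hz : z = w + w⁻¹) (k : ℕ) (hk : 1 ≤ k)
    (X : ℤ → ℂ) (hX : Supp k X) :
    ‖X 0‖ ≤ 1 / (1 - ‖w‖) ^ 2 * ‖E k (L z X)‖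
      + (2 + 2 * ‖z‖) * ((k + 2) * ‖w‖ ^ k) * ‖E k X‖ := by
  set v : ℤ → ℂ := fun j => ((j : ℂ) + 1) * w ^ (j + 2) with hv
  set G : ℕ → ℂ := fun j => v (j - 2) * X j + v (j - 1) * X (j + 1)
    - (v j * X (j - 2) + v (j + 1) * X (j - 1))
    - 2 * z * (v (j - 1) * X j - v j * X (j - 1)) with hG
  have hLv : ∀ j : ℤ, L z v j = 0 := by
    intro j
    simp only [L, hv]
    have e : ∀ a : ℤ, w ^ (j + a) = w ^ j * w ^ a := fun a => zpow_add₀ hw0 _ _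
    have e1 : j - 2 + 2 = j + 0 := by ring
    have e2 : j - 1 + 2 = j + 1 := by ring
    have e3 : j + 1 + 2 = j + 3 := by ring
    have e4 : j + 2 + 2 = j + 4 := by ring
    rw [e1, e2, e3, e4, e, e, e, e, e, hz]
    push_cast
    have f1 : w ^ (3 : ℤ) = w ^ 3 := by norm_cast
    have f2 : w ^ (2 : ℤ) = w ^ 2 := by norm_cast
    have f3 : w ^ (4 : ℤ) = w ^ 4 := by norm_cast
    rw [f1, f2, f3, zpow_zero, zpow_one]
    field_simp
    ring
  have hstep : ∀ j : ℕ, v j * L z X j = G (j + 1) - G j := by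
    intro j
    have h := hLv j
    have : v j * L z X j = v j * L z X j - X j * L z v j := by rw [h]; ring
    rw [this]
    have e1 : ((j : ℕ) : ℤ) + 1 - 2 = j - 1 := by ring
    have e2 : ((j : ℕ) : ℤ) + 1 + 1 = j + 2 := by ring
    have e4 : ((j : ℕ) : ℤ) + 1 - 1 = j := by ring
    simp only [hG, L]
    push_cast
    rw [e1, e2, e4]
    ring
  have hsum : ∑ j ∈ range k, v j * L z X j = G k - G 0 := by
    rw [Finset.sum_congr rfl (fun j _ => hstep j), Finset.sum_range_sub]
  have hG0 : G 0 = - X 0 := by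
    simp [hG, hv, hX (-1) (by simp), hX (-2) (by simp)]
    norm_num
  have hGk : G k = - (v k * X (k - 2) + v (k + 1) * X (k - 1)) + 2 * z * (v k * X (k - 1)) := by
    simp only [hG, hX k (by simp), hX (k + 1) (by omega)]
    ring
  have hr0 := norm_nonneg w
  set r := ‖w‖ with hr
  set N := ‖E k X‖ with hN
  have hvn : ∀ j : ℕ, ‖v j‖ = ((j : ℝ) + 1) * r ^ (j + 2) := by
    intro j
    have e : w ^ ((j : ℤ) + 2) = w ^ (j + 2) := by norm_cast
    have e' : ‖((j : ℂ) + 1)‖ = (j : ℝ) + 1 := by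
      have := Complex.norm_natCast (j + 1)
      push_cast at this; exact this
    simp only [hv]
    rw [e, norm_mul, norm_pow]
    push_cast
    rw [e']
  have hvk : ‖v k‖ ≤ (k + 2) * r ^ k := by
    rw [hvn]
    have : r ^ (k + 2) ≤ r ^ k := pow_le_pow_of_le_one hr0 hw1.le (by omega)
    gcongr
    norm_num
  have hvk1 : ‖v (k + 1)‖ ≤ (k + 2) * r ^ k := by
    have := hvn (k + 1)
    push_cast at this
    rw [this]
    have : r ^ (k + 1 + 2) ≤ r ^ k := pow_le_pow_of_le_one hr0 hw1.le (by omega)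
    gcongr ?_ * ?_
    linarith
  have x1 := coord_le' k X hX (k - 1)
  have x2 := coord_le' k X hX (k - 2)
  have hNn : 0 ≤ N := norm_nonneg _
  have hGkn : ‖G k‖ ≤ (2 + 2 * ‖z‖) * ((k + 2) * r ^ k) * N := by
    rw [hGk]
    set ε := (k + 2) * r ^ k
    have hε : 0 ≤ ε := (norm_nonneg _).trans hvk
    calc _ ≤ ‖v k‖ * ‖X (k - 2)‖ + ‖v (k + 1)‖ * ‖X (k - 1)‖ + 2 * ‖z‖ * (‖v k‖ * ‖X (k - 1)‖) := by
          refine (norm_add_le _ _).trans ?_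
          rw [norm_neg]
          gcongr
          · refine (norm_add_le _ _).trans ?_
            rw [norm_mul (v k), norm_mul (v (k + 1))]
          · simp
      _ ≤ ε * N + ε * N + 2 * ‖z‖ * (ε * N) := by gcongr
      _ = _ := by ring
  have hX0 : X 0 = ∑ j ∈ range k, v j * L z X j - G k := by rw [hsum, hG0]; ring
  rw [hX0]
  refine (norm_sub_le _ _).trans ?_
  gcongr
  calc _ ≤ ∑ j ∈ range k, ‖v j * L z X j‖ := norm_sum_le _ _
    _ ≤ ∑ j ∈ range k, ((j : ℝ) + 1) * r ^ (j + 2) * ‖E k (L z X)‖ := by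
      apply Finset.sum_le_sum
      intro j hj
      rw [norm_mul, hvn]
      gcongr
      exact coord_le k _ j (Finset.mem_range.1 hj)
    _ ≤ _ := by
      rw [← Finset.sum_mul]
      gcongr
      exact sum_bound r hr0 hw1 k

lemma norm_reflect (k : ℕ) (X : ℤ → ℂ) : ‖E k (fun j => X (k - 1 - j))‖ = ‖E k X‖ := by
  have : ‖E k (fun j => X (k - 1 - j))‖ ^ 2 = ‖E k X‖ ^ 2 := by
    rw [norm_sq_E, norm_sq_E, ← Finset.sum_range_reflect]
    apply Finset.sum_congr rfl
    intro j hj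
    have := Finset.mem_range.1 hj
    congr 4
    omega
  exact (pow_left_inj₀ (norm_nonneg _) (norm_nonneg _) two_ne_zero).1 this

lemma key4 (z w : ℂ) (hw0 : w ≠ 0) (hw1 : ‖w‖ < 1) (hz : z = w + w⁻¹) (k : ℕ) (hk : 1 ≤ k)
    (X : ℤ → ℂ) (hX : Supp k X) :
    ‖X (k - 1)‖ ≤ 1 / (1 - ‖w‖) ^ 2 * ‖E k (L z X)‖
      + (2 + 2 * ‖z‖) * ((k + 2) * ‖w‖ ^ k) * ‖E k X‖ := by
  have h := key3 z w hw0 hw1 hz k hk (fun j => X (k - 1 - j)) (fun n hn => hX _ (by omega))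
  have hL : L z (fun j => X (k - 1 - j)) = fun j => L z X (k - 1 - j) := by
    funext j
    simp only [L]
    have e1 : (k : ℤ) - 1 - (j - 2) = k - 1 - j + 2 := by ring
    have e2 : (k : ℤ) - 1 - (j - 1) = k - 1 - j + 1 := by ring
    have e3 : (k : ℤ) - 1 - (j + 2) = k - 1 - j - 2 := by ring
    have e4 : (k : ℤ) - 1 - (j + 1) = k - 1 - j - 1 := by ring
    rw [e1, e2, e3, e4]; ring
  rw [hL, norm_reflect k (L z X), norm_reflect] at h
  simpa using h

/-- extension by zero -/
def ext0 {k : ℕ} (x : EuclideanSpace ℂ (Fin k)) : ℤ → ℂ := fun n =>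
  if h : 0 ≤ n ∧ n < k then x ⟨n.toNat, by omega⟩ else 0

lemma ext0_supp {k : ℕ} (x : EuclideanSpace ℂ (Fin k)) : Supp k (ext0 x) := by
  intro n hn
  unfold ext0
  rw [dif_neg]; omega

lemma E_ext0 {k : ℕ} (x : EuclideanSpace ℂ (Fin k)) : E k (ext0 x) = x := by
  ext j
  simp [E, ext0]

lemma sum_single {k : ℕ} (x : EuclideanSpace ℂ (Fin k)) (n : ℤ) (a : ℂ) :
    ∑ l : Fin k, (if (l : ℤ) = n then a else 0) * x l = a * ext0 x n := by
  unfold ext0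
  split_ifs with h
  · rw [Finset.sum_eq_single (⟨n.toNat, by omega⟩ : Fin k)]
    · rw [if_pos]; simp; omega
    · intro b _ hb
      rw [if_neg, zero_mul]
      intro h'
      apply hb
      ext; simp; omega
    · simp
  · rw [mul_zero]
    apply Finset.sum_eq_zero
    intro l _
    rw [if_neg, zero_mul]
    have := l.2; omega

lemma bhat_eq (z : ℂ) (j l : ℤ) : bhat z (j - l) =
    (if l = j - 2 then 1 else 0) + (if l = j - 1 then -2 * z else 0)
    + (if l = j then 2 + z ^ 2 else 0) + (if l = j + 1 then -2 * z else 0)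
    + (if l = j + 2 then 1 else 0) := by
  unfold bhat
  split_ifs <;> first | omega | simp

lemma T_apply (z : ℂ) (k : ℕ) (x : EuclideanSpace ℂ (Fin k)) :
    Matrix.toEuclideanCLM (𝕜 := ℂ) (Tbeta z k) x = E k (L z (ext0 x)) := by
  ext j
  have : (Matrix.toEuclideanCLM (𝕜 := ℂ) (Tbeta z k) x) j = ∑ l : Fin k, bhat z (j - l) * x l := by
    rw [Matrix.ofLp_toEuclideanCLM]
    rfl
  rw [this]
  simp only [bhat_eq, add_mul, Finset.sum_add_distrib, sum_single]
  simp only [E, L]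
  ring

lemma exists_w (z : ℂ) (hz : z ∉ I22) : ∃ w : ℂ, w ≠ 0 ∧ ‖w‖ < 1 ∧ z = w + w⁻¹ := by
  obtain ⟨s, hs⟩ := IsAlgClosed.exists_pow_nat_eq (z ^ 2 - 4) (n := 2) (by norm_num)
  set a := (z + s) / 2 with ha
  set b := (z - s) / 2 with hb
  have hab : a * b = 1 := by rw [ha, hb]; linear_combination (-1 / 4) * hs
  have hsum : z = a + b := by rw [ha, hb]; ring
  have ha0 : a ≠ 0 := left_ne_zero_of_mul_eq_one hab
  have hb0 : b ≠ 0 := right_ne_zero_of_mul_eq_one hab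
  have hbi : b = a⁻¹ := eq_inv_of_mul_eq_one_right hab
  have hai : a = b⁻¹ := eq_inv_of_mul_eq_one_left hab
  rcases lt_trichotomy ‖a‖ 1 with h | h | h
  · exact ⟨a, ha0, h, by rw [← hbi]; exact hsum⟩
  · exfalso
    apply hz
    have h2 : b = (starRingEnd ℂ) a := by rw [hbi, Complex.inv_eq_conj h]
    have h3 := abs_le.1 ((Complex.abs_re_le_norm a).trans h.le)
    refine ⟨2 * a.re, ⟨by linarith, by linarith⟩, ?_⟩
    rw [hsum, h2, Complex.add_conj]
  · refine ⟨b, hb0, ?_, by rw [← hai, add_comm]; exact hsum⟩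
    rw [hbi, norm_inv]
    exact inv_lt_one_of_one_lt₀ h

lemma I22_compact : IsCompact I22 :=
  isCompact_Icc.image Complex.continuous_ofReal

lemma I22_nonempty : I22.Nonempty := ⟨_, 0, by norm_num, rfl⟩

lemma norm_z_le (z : ℂ) (R : ℝ) (h : Metric.infDist z I22 ≤ R) : ‖z‖ ≤ R + 2 := by
  obtain ⟨y, hy, hd⟩ := I22_compact.exists_infDist_eq_dist I22_nonempty z
  rw [hd, dist_eq_norm] at h
  obtain ⟨t, ht, rfl⟩ := hy
  have h2 : ‖(t : ℂ)‖ ≤ 2 := by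
    rw [Complex.norm_real, Real.norm_eq_abs]; exact abs_le.2 ⟨ht.1, ht.2⟩
  have := norm_le_norm_sub_add z (t : ℂ)
  simp only at h
  linarith

lemma dist_w (z w : ℂ) (R : ℝ) (h : Metric.infDist z I22 ≤ R)
    (hw0 : w ≠ 0) (hw1 : ‖w‖ < 1) (hz : z = w + w⁻¹) :
    Metric.infDist z I22 ≤ 2 * (R + 3) * (1 - ‖w‖) := by
  have hzn := norm_z_le z R h
  have hr : 0 < ‖w‖ := norm_pos_iff.2 hw0
  set r := ‖w‖ with hrd
  have hrC : (r : ℂ) ≠ 0 := by exact_mod_cast hr.ne'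
  have hinv : r⁻¹ ≤ R + 3 := by
    have : w⁻¹ = z - w := by rw [hz]; ring
    have h2 := norm_sub_le z w
    rw [← this, norm_inv] at h2
    linarith
  have hre := abs_le.1 (Complex.abs_re_le_norm w)
  have hmem : ((2 * w.re / r : ℝ) : ℂ) ∈ I22 := by
    refine ⟨_, ⟨?_, ?_⟩, rfl⟩
    · rw [le_div_iff₀ hr]; linarith
    · rw [div_le_iff₀ hr]; linarith
  have hd := Metric.infDist_le_dist_of_mem (x := z) hmem
  rw [dist_eq_norm] at hd
  have hcw : (starRingEnd ℂ) w = r ^ 2 * w⁻¹ := by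
    have := Complex.mul_conj' w
    rw [← hrd] at this
    field_simp
    rw [mul_comm]; exact this
  have e : z - ((2 * w.re / r : ℝ) : ℂ) = ((1 - r⁻¹ : ℝ) : ℂ) * w + ((1 - r : ℝ) : ℂ) * w⁻¹ := by
    have h1 : ((2 * w.re / r : ℝ) : ℂ) = (w + (starRingEnd ℂ) w) / r := by
      rw [Complex.add_conj]; push_cast; ring
    rw [h1, hcw, hz]
    push_cast
    field_simp
    ring
  have h1r : 1 ≤ r⁻¹ := (one_le_inv₀ hr).2 hw1.le
  have hn : ‖z - ((2 * w.re / r : ℝ) : ℂ)‖ ≤ (r⁻¹ - 1) * r + (1 - r) * r⁻¹ := by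
    rw [e]
    refine (norm_add_le _ _).trans ?_
    rw [norm_mul, norm_mul, Complex.norm_real, Complex.norm_real, norm_inv, ← hrd,
      Real.norm_eq_abs, Real.norm_eq_abs, abs_of_nonpos (by linarith), abs_of_nonneg (by linarith)]
    simp
  have e2 : (r⁻¹ - 1) * r = 1 - r := by field_simp
  rw [e2] at hn
  have : (1 - r) * r⁻¹ ≤ (1 - r) * (R + 3) := by
    apply mul_le_mul_of_nonneg_left hinv; linarith
  nlinarith

lemma small (C c q : ℝ) (hc : 0 < c) (hq : 1 < q) :
    ∃ K : ℝ, 1 ≤ K ∧ ∀ k : ℝ, K ≤ k → C * ((k + 2) * Real.exp (-c * k ^ (1 - 1 / q))) * k ^ 2 ≤ 1 := by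
  set α := 1 - 1 / q with hα
  have hα0 : 0 < α := by
    have : 1 / q < 1 := by rw [div_lt_one (by linarith)]; exact hq
    rw [hα]; linarith
  have h1 := (tendsto_rpow_mul_exp_neg_mul_atTop_nhds_zero (3 / α) c hc).comp
    (tendsto_rpow_atTop hα0)
  have h2 := h1.eventually (gt_mem_nhds (show (0 : ℝ) < 1 / (3 * (|C| + 1)) by positivity))
  obtain ⟨K, hK⟩ := Filter.eventually_atTop.1 h2
  refine ⟨max K 1, le_max_right _ _, fun k hk => ?_⟩
  have hk1 : 1 ≤ k := (le_max_right _ _).trans hk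
  have h3 := hK k ((le_max_left _ _).trans hk)
  simp only [Function.comp] at h3
  rw [← Real.rpow_mul (by linarith), mul_div_cancel₀ _ hα0.ne', lt_div_iff₀ (by positivity)] at h3
  have e : k ^ (3 : ℝ) = k ^ 3 := by norm_cast
  rw [e] at h3
  set x := Real.exp (-c * k ^ α)
  have hx : 0 < x := Real.exp_pos _
  have hC := le_abs_self C
  calc C * ((k + 2) * x) * k ^ 2 ≤ (|C| + 1) * ((3 * k) * x) * k ^ 2 := by
        gcongr <;> linarith
    _ = k ^ 3 * x * (3 * (|C| + 1)) := by ring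
    _ ≤ 1 := h3.le

lemma of_bound (k : ℕ) (T : Matrix (Fin k) (Fin k) ℂ) (B : ℝ) (hB : 0 ≤ B)
    (h : ∀ x : EuclideanSpace ℂ (Fin k), ‖x‖ ≤ B * ‖Matrix.toEuclideanCLM (𝕜 := ℂ) T x‖) :
    IsUnit T ∧ ‖Matrix.toEuclideanCLM (𝕜 := ℂ) T⁻¹‖ ≤ B := by
  have hu : IsUnit T := by
    rw [← Matrix.mulVec_injective_iff_isUnit]
    rw [← Matrix.coe_mulVecLin, injective_iff_map_eq_zero]
    intro v hv
    have := h (WithLp.toLp 2 v)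
    have h0 : Matrix.toEuclideanCLM (𝕜 := ℂ) T (WithLp.toLp 2 v) = 0 := by
      rw [Matrix.toEuclideanCLM_toLp]
      simpa using hv
    rw [h0, norm_zero, mul_zero, norm_le_zero_iff] at this
    simpa using this
  refine ⟨hu, ContinuousLinearMap.opNorm_le_bound _ hB fun y => ?_⟩
  refine (h _).trans (le_of_eq ?_)
  rw [← mul_apply_eq_comp, ← map_mul,
    Matrix.mul_nonsing_inv _ ((Matrix.isUnit_iff_isUnit_det _).1 hu), map_one]
  simp

end Stmt5

open Stmt5

/-- for every `R > 0` and `1 < q < 2` there are `b₆, b₇ > 0` such that for all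
`z ∉ [−2,2]` with `d(z) ≤ R` and all `k ≥ b₇/d(z)^q`, the matrix `T_k(β)` is invertible
with `‖T_k(β)⁻¹‖ ≤ b₆/d(z)⁸`. -/
theorem stmt_5 :
    ∀ R : ℝ, 0 < R → ∀ q : ℝ, 1 < q → q < 2 →
      ∃ b₆ b₇ : ℝ, 0 < b₆ ∧ 0 < b₇ ∧
        ∀ z : ℂ, z ∉ I22 → Metric.infDist z I22 ≤ R →
          ∀ k : ℕ, b₇ / Metric.infDist z I22 ^ q ≤ (k : ℝ) →
            IsUnit (Tbeta z k) ∧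
            ‖Matrix.toEuclideanCLM (𝕜 := ℂ) (Tbeta z k)⁻¹‖ ≤
              b₆ / Metric.infDist z I22 ^ (8 : ℕ) := by
  intro R hR q hq1 hq2
  set c : ℝ := 1 / (2 * (R + 3)) with hc
  have hc0 : 0 < c := by positivity
  obtain ⟨K, hK1, hK⟩ := small (4 * (2 * R + 6)) c q hc0 hq1
  refine ⟨2 * R ^ 6 + 4 / c ^ 2 * R ^ 4, max 1 (K * R ^ q), by positivity, by positivity, ?_⟩
  intro z hz hdR k hk
  set d := Metric.infDist z I22 with hd
  have hd0 : 0 < d :=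
    (I22_compact.isClosed.notMem_iff_infDist_pos I22_nonempty).1 hz
  have hdq : 0 < d ^ q := Real.rpow_pos_of_pos hd0 q
  rw [div_le_iff₀ hdq] at hk
  have hk1 : 1 ≤ (k : ℝ) * d ^ q := (le_max_left _ _).trans hk
  have hk2 : K * R ^ q ≤ (k : ℝ) * d ^ q := (le_max_right _ _).trans hk
  have hRq : 0 < R ^ q := Real.rpow_pos_of_pos hR q
  have hdRq : d ^ q ≤ R ^ q := Real.rpow_le_rpow hd0.le hdR (by linarith)
  have hKk : K ≤ k := by
    have : K * R ^ q ≤ k * R ^ q := hk2.trans (by gcongr)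
    exact le_of_mul_le_mul_right this hRq
  have hkone : (1 : ℝ) ≤ k := hK1.trans hKk
  have hkpos : (0 : ℝ) < k := by linarith
  have hkN : 1 ≤ k := by exact_mod_cast hkone
  have hsm := hK k hKk
  obtain ⟨w, hw0, hw1, hzw⟩ := exists_w z hz
  have hdw := dist_w z w R hdR hw0 hw1 hzw
  have hzn := norm_z_le z R hdR
  rw [← hd] at hdw
  set r := ‖w‖ with hr
  have hr0 : 0 ≤ r := norm_nonneg _
  have hcd : c * d ≤ 1 - r := by
    rw [hc, one_div, inv_mul_le_iff₀ (by positivity)]; exact hdw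
  -- `k^(-1/q) ≤ d`
  have hkd : (k : ℝ) ^ (-(1 / q)) ≤ d := by
    have h1 : (k : ℝ)⁻¹ ≤ d ^ q := by rw [inv_le_iff_one_le_mul₀ hkpos, mul_comm]; exact hk1
    have h2 := Real.rpow_le_rpow (by positivity) h1 (show 0 ≤ 1 / q by positivity)
    rw [← Real.rpow_mul hd0.le, mul_one_div_cancel (by linarith), Real.rpow_one,
      Real.inv_rpow hkpos.le, ← Real.rpow_neg hkpos.le] at h2
    exact h2
  have hkd1 : 1 ≤ k * d := by
    have h1 : (k : ℝ) ^ (-1 : ℝ) ≤ (k : ℝ) ^ (-(1 / q)) := by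
      apply Real.rpow_le_rpow_of_exponent_le hkone
      have : 1 / q ≤ 1 := by rw [div_le_one (by linarith)]; linarith
      linarith
    rw [Real.rpow_neg_one] at h1
    have := h1.trans hkd
    rwa [inv_le_iff_one_le_mul₀ hkpos, mul_comm] at this
  have hkα : (k : ℝ) ^ (1 - 1 / q) ≤ k * d := by
    rw [sub_eq_add_neg, Real.rpow_add hkpos, Real.rpow_one]
    gcongr
  have hrk : r ^ k ≤ Real.exp (-c * (k : ℝ) ^ (1 - 1 / q)) := by
    have h1 : r ≤ Real.exp (-(c * d)) := by
      have := Real.add_one_le_exp (-(c * d)); linarith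
    calc r ^ k ≤ Real.exp (-(c * d)) ^ k := by gcongr
      _ = Real.exp (-c * (k * d)) := by rw [← Real.exp_nat_mul]; ring_nf
      _ ≤ _ := by
        apply Real.exp_le_exp.2
        nlinarith
  have hε : 4 * ((2 + 2 * ‖z‖) * ((k + 2) * r ^ k)) ≤ d ^ 2 := by
    have h1 : 4 * ((2 + 2 * ‖z‖) * ((k + 2) * r ^ k)) ≤
        4 * (2 * R + 6) * ((k + 2) * Real.exp (-c * (k : ℝ) ^ (1 - 1 / q))) := by
      have h2 : 2 + 2 * ‖z‖ ≤ 2 * R + 6 := by linarith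
      rw [← mul_assoc]
      gcongr 4 * ?_ * ((k + 2) * ?_)
    have hkd2 : 1 ≤ (k : ℝ) ^ 2 * d ^ 2 := by nlinarith
    refine h1.trans ?_
    have h3 : 4 * (2 * R + 6) * ((k + 2) * Real.exp (-c * (k : ℝ) ^ (1 - 1 / q))) * (k : ℝ) ^ 2
        ≤ d ^ 2 * (k : ℝ) ^ 2 := hsm.trans (by linarith)
    exact le_of_mul_le_mul_right h3 (by positivity)
  apply of_bound
  · positivity
  intro x
  rw [T_apply]
  have hX := ext0_supp x
  have a2 := key2 z k hkN _ hX
  have a3 := key3 z w hw0 hw1 hzw k hkN _ hX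
  have a4 := key4 z w hw0 hw1 hzw k hkN _ hX
  rw [E_ext0] at a2 a3 a4
  rw [← hd] at a2
  rw [← hr] at a3 a4
  set f := ‖E k (L z (ext0 x))‖ with hf
  have hf0 : 0 ≤ f := norm_nonneg _
  set ε := (2 + 2 * ‖z‖) * ((k + 2) * r ^ k) with hεd
  have hx0 := norm_nonneg x
  have hV : 1 / (1 - r) ^ 2 ≤ 1 / (c * d) ^ 2 := by gcongr
  have hVf := mul_le_mul_of_nonneg_right hV hf0
  have hεx := mul_le_mul_of_nonneg_right hε hx0
  have h5 : d ^ 2 * ‖x‖ ≤ 2 * (1 + 2 * (1 / (c * d) ^ 2)) * f := by linarith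
  have h6 : ‖x‖ ≤ (2 / d ^ 2 + 4 / c ^ 2 / d ^ 4) * f := by
    have : (2 / d ^ 2 + 4 / c ^ 2 / d ^ 4) * f = (2 * (1 + 2 * (1 / (c * d) ^ 2)) * f) / d ^ 2 := by
      field_simp
      ring
    rw [this, le_div_iff₀ (by positivity)]
    linarith
  refine h6.trans ?_
  gcongr
  have e : 2 / d ^ 2 + 4 / c ^ 2 / d ^ 4 = (2 * d ^ 6 + 4 / c ^ 2 * d ^ 4) / d ^ 8 := by
    field_simp
  rw [e]
  gcongr
end
end

section
/- For every integer p ≥ 1 and every R > 0 there exists a constant b > 0, independent of z, such that for all z ∈ ℂ with z ∉ [−2,2] and d(z) ≤ R: Σ_{n∈ℤ} |n|^p |\widehat{β^{-1}}(n; z)| ≤ b/d(z)^{p+3} and (Σ_{n∈ℤ} |n|^{2p} |\widehat{β^{-1}}(n; z)|²)^{1/2} ≤ b/d(z)^{p+2}. -/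
open scoped ENNReal

noncomputable section

/-- Fourier coefficients of the symbol `β⁻¹(e^{iθ};z) = (2cosθ − z)⁻²`:
`(1/2π)∫_{-π}^{π} e^{-inθ}(2cosθ − z)⁻² dθ`. -/
noncomputable def binvhat (z : ℂ) (n : ℤ) : ℂ :=
  (1 / (2 * Real.pi) : ℝ) • ∫ θ in (-Real.pi)..Real.pi,
    Complex.exp (-(n : ℂ) * Complex.I * (θ : ℂ)) * (2 * (Real.cos θ : ℂ) - z) ^ (-2 : ℤ)

lemma aux_pi : (-Real.pi) < Real.pi := by linarith [Real.pi_pos]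

/-- The weighted symbol. -/
def auxF (z : ℂ) (m : ℕ) (u : ℝ → ℂ) (θ : ℝ) : ℂ :=
  u θ * ((2 * (Real.cos θ : ℂ) - z) ^ m)⁻¹

/-- Fourier coefficients on `[-π, π]`. -/
def auxC (f : ℝ → ℂ) (n : ℤ) : ℂ := fourierCoeffOn aux_pi f n

lemma binvhat_eq (z : ℂ) (n : ℤ) : binvhat z n = auxC (auxF z 2 (fun _ => 1)) n := by
  unfold binvhat auxC
  rw [fourierCoeffOn_eq_integral]
  congr 1
  · ring_nf
  · apply intervalIntegral.integral_congr
    intro x _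
    simp only [fourier_coe_apply, auxF, smul_eq_mul, one_mul]
    have hpi : (Real.pi : ℂ) ≠ 0 := by exact_mod_cast Real.pi_ne_zero
    congr 1
    congr 1
    push_cast
    field_simp
    ring

lemma I22_closed : IsClosed I22 :=
  (isCompact_Icc.image Complex.continuous_ofReal).isClosed

lemma cos_mem (θ : ℝ) : (2 * (Real.cos θ : ℂ)) ∈ I22 := by
  refine ⟨2 * Real.cos θ, ⟨?_, ?_⟩, by push_cast; rfl⟩
  · linarith [Real.neg_one_le_cos θ]
  · linarith [Real.cos_le_one θ]

lemma d_pos {z : ℂ} (hz : z ∉ I22) : 0 < Metric.infDist z I22 :=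
  (I22_closed.notMem_iff_infDist_pos ⟨_, cos_mem 0⟩).1 hz

lemma d_le (z : ℂ) (θ : ℝ) : Metric.infDist z I22 ≤ ‖2 * (Real.cos θ : ℂ) - z‖ := by
  have := Metric.infDist_le_dist_of_mem (x := z) (cos_mem θ)
  rwa [dist_comm, dist_eq_norm] at this

lemma ne_zero_of {z : ℂ} (hz : z ∉ I22) (θ : ℝ) : 2 * (Real.cos θ : ℂ) - z ≠ 0 := by
  have := (d_pos hz).trans_le (d_le z θ)
  exact norm_pos_iff.1 this

lemma auxF_cont {z : ℂ} (hz : z ∉ I22) (m : ℕ) {u : ℝ → ℂ} (hu : Continuous u) :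
    Continuous (auxF z m u) := by
  unfold auxF
  refine hu.mul (Continuous.inv₀ (by fun_prop) fun θ => pow_ne_zero _ (ne_zero_of hz θ))

lemma auxF_deriv {z : ℂ} (hz : z ∉ I22) (m : ℕ) {u : ℝ → ℂ} (hu : Differentiable ℝ u) (θ : ℝ) :
    HasDerivAt (auxF z m u)
      (auxF z m (deriv u) θ + auxF z (m + 1) (fun t => u t * (2 * m * (Real.sin t : ℂ))) θ) θ := by
  have h1 := (hu θ).hasDerivAt
  have h2 : HasDerivAt (fun t : ℝ => 2 * (Real.cos t : ℂ) - z) (2 * ((-Real.sin θ : ℝ) : ℂ)) θ :=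
    ((Real.hasDerivAt_cos θ).ofReal_comp.const_mul 2).sub_const z
  have hne := ne_zero_of hz θ
  have h3 := h1.mul ((h2.pow m).inv (pow_ne_zero m hne))
  refine h3.congr_deriv ?_
  unfold auxF
  rcases m with _ | m
  · simp
  · simp only [Pi.pow_apply, Pi.inv_apply, Nat.add_sub_cancel]
    generalize 2 * (Real.cos θ : ℂ) - z = w at hne
    push_cast
    field_simp
    ring

lemma auxC_sum {f : ℝ → ℂ} (hf : Continuous f) {B : ℝ} (hB : ∀ θ, ‖f θ‖ ≤ B) :
    Summable (fun n : ℤ => ‖auxC f n‖ ^ 2) ∧ ∑' n : ℤ, ‖auxC f n‖ ^ 2 ≤ B ^ 2 := by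
  have hL : MeasureTheory.MemLp f 2
      (MeasureTheory.volume.restrict (Set.Ioc (-Real.pi) Real.pi)) :=
    MeasureTheory.MemLp.of_bound hf.aestronglyMeasurable B (Filter.Eventually.of_forall hB)
  have h := hasSum_sq_fourierCoeffOn aux_pi hL
  refine ⟨h.summable, ?_⟩
  unfold auxC
  rw [h.tsum_eq]
  have : ∫ x in (-Real.pi)..Real.pi, ‖f x‖ ^ 2 ≤ ∫ x in (-Real.pi)..Real.pi, B ^ 2 := by
    apply intervalIntegral.integral_mono_on aux_pi.le
    · exact (hf.norm.pow 2).intervalIntegrable _ _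
    · exact continuous_const.intervalIntegrable _ _
    · intro x _
      exact pow_le_pow_left₀ (norm_nonneg _) (hB x) 2
  rw [intervalIntegral.integral_const] at this
  have hp : 0 < Real.pi - -Real.pi := by linarith [Real.pi_pos]
  simp only [smul_eq_mul] at *
  rw [inv_mul_le_iff₀ hp]
  exact this

lemma auxC_add {f g : ℝ → ℂ} (hf : Continuous f) (hg : Continuous g) (n : ℤ) :
    auxC (fun t => f t + g t) n = auxC f n + auxC g n := by
  unfold auxC
  simp only [fourierCoeffOn_eq_integral]
  rw [← smul_add, ← intervalIntegral.integral_add]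
  · simp only [smul_add]
  · apply Continuous.intervalIntegrable
    exact ((fourier (-n)).continuous.comp (AddCircle.continuous_mk' _)).smul hf
  · apply Continuous.intervalIntegrable
    exact ((fourier (-n)).continuous.comp (AddCircle.continuous_mk' _)).smul hg

lemma auxC_deriv {f f' : ℝ → ℂ} (hf : ∀ x, HasDerivAt f (f' x) x) (hf' : Continuous f')
    (hper : f Real.pi = f (-Real.pi)) (n : ℤ) :
    |(n : ℝ)| * ‖auxC f n‖ ≤ ‖auxC f' n‖ := by
  rcases eq_or_ne n 0 with rfl | hn
  · simp
  have h := fourierCoeffOn_of_hasDerivAt aux_pi hn (fun x _ => hf x)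
    (hf'.intervalIntegrable _ _)
  unfold auxC
  rw [h, hper]
  have hn' : 0 < |(n : ℝ)| := by positivity
  have hpi := Real.pi_pos
  have e : (1 / (-2 * (Real.pi : ℂ) * Complex.I * n) *
      (fourier (-n) ((-Real.pi : ℝ) : AddCircle (Real.pi - -Real.pi)) *
        (f (-Real.pi) - f (-Real.pi)) -
        ((Real.pi : ℝ) - (-Real.pi : ℝ) : ℂ) * fourierCoeffOn aux_pi f' n))
      = (1 / (Complex.I * n)) * fourierCoeffOn aux_pi f' n := by
    have hpi' : (Real.pi : ℂ) ≠ 0 := by exact_mod_cast Real.pi_ne_zero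
    have hn'' : (n : ℂ) ≠ 0 := by exact_mod_cast hn
    push_cast
    field_simp
    ring
  push_cast at e ⊢
  rw [e, norm_mul]
  simp only [norm_div, norm_mul, Complex.norm_I, norm_one, Complex.norm_intCast, one_mul]
  rw [← mul_assoc, mul_one_div_cancel hn'.ne', one_mul]

lemma aux_bdd {u : ℝ → ℂ} (hu : Continuous u) (hp : Function.Periodic u (2 * Real.pi)) :
    ∃ B : ℝ, 0 < B ∧ ∀ θ, ‖u θ‖ ≤ B := by
  obtain ⟨B, hB⟩ := (isCompact_Icc (a := (0 : ℝ)) (b := 2 * Real.pi)).exists_bound_of_continuousOn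
    hu.continuousOn
  refine ⟨max B 1, by positivity, fun θ => ?_⟩
  obtain ⟨y, hy, e⟩ := hp.exists_mem_Ico₀ (by positivity) θ
  rw [e]
  exact (hB y ⟨hy.1, hy.2.le⟩).trans (le_max_left _ _)

lemma deriv_per {u : ℝ → ℂ} {T : ℝ} (hp : Function.Periodic u T) :
    Function.Periodic (deriv u) T := by
  intro x
  rw [← deriv_comp_add_const]
  congr 1
  funext y
  exact hp y

lemma master (R : ℝ) (hR : 0 < R) (q : ℕ) : ∀ (m : ℕ) (u : ℝ → ℂ), ContDiff ℝ (⊤ : ℕ∞) u →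
    Function.Periodic u (2 * Real.pi) → ∃ C : ℝ, 0 < C ∧
      ∀ z : ℂ, z ∉ I22 → Metric.infDist z I22 ≤ R →
        Summable (fun n : ℤ => (|(n : ℝ)| ^ q * ‖auxC (auxF z m u) n‖) ^ 2) ∧
        ∑' n : ℤ, (|(n : ℝ)| ^ q * ‖auxC (auxF z m u) n‖) ^ 2 ≤
          (C / Metric.infDist z I22 ^ (m + q)) ^ 2 := by
  induction q with
  | zero =>
    intro m u hu hp
    obtain ⟨B, hB0, hB⟩ := aux_bdd hu.continuous hp
    refine ⟨B, hB0, fun z hz _ => ?_⟩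
    simp only [pow_zero, one_mul, add_zero]
    apply auxC_sum (auxF_cont hz m hu.continuous)
    intro θ
    unfold auxF
    rw [norm_mul, norm_inv, norm_pow, div_eq_mul_inv]
    have := d_pos hz
    have := d_le z θ
    have := hB θ
    gcongr
  | succ q ih =>
    intro m u hu hp
    have hu1 : ContDiff ℝ (⊤ : ℕ∞) (deriv u) := by
      exact (contDiff_infty_iff_deriv.1 hu).2
    have hs : ContDiff ℝ (⊤ : ℕ∞) (fun t : ℝ => (Real.sin t : ℂ)) :=
      Complex.ofRealCLM.contDiff.comp Real.contDiff_sin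
    have hu2 : ContDiff ℝ (⊤ : ℕ∞) (fun t => u t * (2 * m * (Real.sin t : ℂ))) :=
      hu.mul (contDiff_const.mul hs)
    have hp2 : Function.Periodic (fun t => u t * (2 * m * (Real.sin t : ℂ))) (2 * Real.pi) := by
      intro t
      simp only [hp t, Real.sin_add_two_pi]
    obtain ⟨C1, hC1, h1⟩ := ih m _ hu1 (deriv_per hp)
    obtain ⟨C2, hC2, h2⟩ := ih (m + 1) _ hu2 hp2
    refine ⟨2 * (C1 * R + C2), by positivity, fun z hz hzR => ?_⟩
    obtain ⟨s1, t1⟩ := h1 z hz hzR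
    obtain ⟨s2, t2⟩ := h2 z hz hzR
    have hd := d_pos hz
    have c1 := auxF_cont hz m hu1.continuous
    have c2 := auxF_cont hz (m + 1) hu2.continuous
    have key : ∀ n : ℤ, (|(n : ℝ)| ^ (q + 1) * ‖auxC (auxF z m u) n‖) ^ 2 ≤
        2 * (|(n : ℝ)| ^ q * ‖auxC (auxF z m (deriv u)) n‖) ^ 2 +
        2 * (|(n : ℝ)| ^ q * ‖auxC (auxF z (m + 1)
          (fun t => u t * (2 * m * (Real.sin t : ℂ)))) n‖) ^ 2 := by
      intro n
      have hh := auxC_deriv (auxF_deriv hz m (hu.differentiable (by simp))) (c1.add c2)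
        (by
          have hpp := hp (-Real.pi)
          rw [show -Real.pi + 2 * Real.pi = Real.pi by ring] at hpp
          simp [auxF, hpp]) n
      rw [auxC_add c1 c2] at hh
      have h3 := hh.trans (norm_add_le _ _)
      have h4 := mul_le_mul_of_nonneg_left h3 (pow_nonneg (abs_nonneg (n : ℝ)) q)
      have h5 : |(n : ℝ)| ^ (q + 1) * ‖auxC (auxF z m u) n‖ ≤
        |(n : ℝ)| ^ q * ‖auxC (auxF z m (deriv u)) n‖ + |(n : ℝ)| ^ q * ‖auxC (auxF z (m + 1)
          (fun t => u t * (2 * m * (Real.sin t : ℂ)))) n‖ := by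
        rw [← mul_add, pow_succ, mul_assoc]
        exact h4
      refine (pow_le_pow_left₀ (by positivity) h5 2).trans ?_
      generalize |(n : ℝ)| ^ q * ‖auxC (auxF z m (deriv u)) n‖ = a
      generalize |(n : ℝ)| ^ q * ‖auxC (auxF z (m + 1) _) n‖ = b
      nlinarith [sq_nonneg (a - b)]
    have hsum := (s1.mul_left 2).add (s2.mul_left 2)
    have hS := Summable.of_nonneg_of_le (fun n => sq_nonneg _) key hsum
    refine ⟨hS, (hS.tsum_le_tsum key hsum).trans ?_⟩
    rw [(s1.mul_left 2).tsum_add (s2.mul_left 2), tsum_mul_left, tsum_mul_left]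
    set d := Metric.infDist z I22
    have e1 : C1 / d ^ (m + q) ≤ C1 * R / d ^ (m + (q + 1)) := by
      rw [div_le_div_iff₀ (by positivity) (by positivity), ← add_assoc, pow_succ]
      have : C1 * (d ^ (m + q)) * d ≤ C1 * (d ^ (m + q)) * R := by gcongr
      linarith
    have e2 : C2 / d ^ (m + 1 + q) = C2 / d ^ (m + (q + 1)) := by
      congr 2; ring
    rw [e2] at t2
    have e3 : 2 * (C1 * R + C2) / d ^ (m + (q + 1)) =
      2 * (C1 * R / d ^ (m + (q + 1)) + C2 / d ^ (m + (q + 1))) := by ring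
    rw [e3]
    have p1 : 0 < C1 / d ^ (m + q) := by positivity
    have p2 : 0 < C2 / d ^ (m + (q + 1)) := by positivity
    have p3 : 0 < C1 * R / d ^ (m + (q + 1)) := by positivity
    have t1' := t1.trans (pow_le_pow_left₀ p1.le e1 2)
    generalize C1 * R / d ^ (m + (q + 1)) = a at *
    generalize C2 / d ^ (m + (q + 1)) = b at *
    nlinarith [mul_pos p2 p3]

lemma ennreal_tsum_le {f : ℤ → ℝ≥0∞} {g : ℤ → ℝ} (hg : ∀ n, 0 ≤ g n) (hs : Summable g)
    (e : ∀ n, f n ≤ ENNReal.ofReal (g n)) {B : ℝ} (hB : ∑' n, g n ≤ B) :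
    ∑' n, f n ≤ ENNReal.ofReal B := by
  calc ∑' n, f n ≤ ∑' n, ENNReal.ofReal (g n) := ENNReal.tsum_le_tsum e
    _ = ENNReal.ofReal (∑' n, g n) := (ENNReal.ofReal_tsum_of_nonneg hg hs).symm
    _ ≤ _ := ENNReal.ofReal_le_ofReal hB

lemma coe_eq (n : ℤ) (k : ℕ) (c : ℂ) (j : ℕ) :
    ((n.natAbs : ℝ≥0∞)) ^ k * (‖c‖₊ : ℝ≥0∞) ^ j = ENNReal.ofReal (|(n : ℝ)| ^ k * ‖c‖ ^ j) := by
  rw [ENNReal.ofReal_mul (by positivity), ENNReal.ofReal_pow (by positivity),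
    ENNReal.ofReal_pow (by positivity), ofReal_norm]
  congr 2
  have : |(n : ℝ)| = (n.natAbs : ℝ) := by simp
  rw [this, ENNReal.ofReal_natCast]

/-- for each integer `p ≥ 1` and each `R > 0` there is `b > 0` with
`Σ_{n∈ℤ} |n|^p |β̂⁻¹(n;z)| ≤ b/d(z)^{p+3}` and
`(Σ_{n∈ℤ} |n|^{2p} |β̂⁻¹(n;z)|²)^{1/2} ≤ b/d(z)^{p+2}` for all `z ∉ [−2,2]`, `d(z) ≤ R`
(the sums are taken in `ℝ≥0∞`, so finiteness is part of the claim). -/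
theorem stmt_12 (p : ℕ) (hp : 1 ≤ p) :
    ∀ R : ℝ, 0 < R → ∃ b : ℝ, 0 < b ∧
      ∀ z : ℂ, z ∉ I22 → Metric.infDist z I22 ≤ R →
        (∑' n : ℤ, ((n.natAbs : ℝ≥0∞)) ^ p * (‖binvhat z n‖₊ : ℝ≥0∞)) ≤
            ENNReal.ofReal (b / Metric.infDist z I22 ^ (p + 3)) ∧
        (∑' n : ℤ, ((n.natAbs : ℝ≥0∞)) ^ (2 * p) * (‖binvhat z n‖₊ : ℝ≥0∞) ^ 2) ^
              ((1 : ℝ) / 2) ≤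
            ENNReal.ofReal (b / Metric.infDist z I22 ^ (p + 2)) := by
  intro R hR
  have hu : ContDiff ℝ (⊤ : ℕ∞) (fun _ : ℝ => (1 : ℂ)) := contDiff_const
  have hp1 : Function.Periodic (fun _ : ℝ => (1 : ℂ)) (2 * Real.pi) := fun _ => rfl
  obtain ⟨C1, hC1, h1⟩ := master R hR p 2 _ hu hp1
  obtain ⟨C2, hC2, h2⟩ := master R hR (p + 1) 2 _ hu hp1
  have hS : Summable (fun n : ℤ => 1 / (n : ℝ) ^ 2) := by
    exact Real.summable_one_div_int_pow.2 (by norm_num)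
  set S := ∑' n : ℤ, 1 / (n : ℝ) ^ 2 with hSdef
  have hS0 : 0 ≤ S := tsum_nonneg fun n => by positivity
  refine ⟨C1 + C2 ^ 2 + S, by positivity, fun z hz hzR => ?_⟩
  obtain ⟨s1, t1⟩ := h1 z hz hzR
  obtain ⟨s2, t2⟩ := h2 z hz hzR
  have hd := d_pos hz
  simp only [← binvhat_eq] at s1 t1 s2 t2
  set d := Metric.infDist z I22
  constructor
  · set t := d ^ (p + 3) with ht
    have ht0 : 0 < t := by positivity
    have hsum := (s2.mul_left t).add (hS.mul_left (1 / t))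
    refine ennreal_tsum_le
      (g := fun n : ℤ => t * (|(n : ℝ)| ^ (p + 1) * ‖binvhat z n‖) ^ 2 + 1 / t * (1 / (n : ℝ) ^ 2))
      (fun n => by positivity) hsum ?_ ?_
    · intro n
      have := coe_eq n p (binvhat z n) 1
      rw [pow_one, pow_one] at this
      rw [this]
      apply ENNReal.ofReal_le_ofReal
      rcases eq_or_ne n 0 with rfl | hn
      · simp [show p ≠ 0 by omega]
      · have ha : 0 < |(n : ℝ)| := by positivity
        rw [← sq_abs (n : ℝ)]
        set a := |(n : ℝ)|
        have hx : 0 ≤ a ^ p * ‖binvhat z n‖ := by positivity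
        have e1 : a ^ (p + 1) * ‖binvhat z n‖ = (a ^ p * ‖binvhat z n‖) * a := by ring
        rw [e1]
        generalize a ^ p * ‖binvhat z n‖ = x at *
        have e2 : t * (x * a) ^ 2 + 1 / t * (1 / a ^ 2) - x =
          ((t * x * a ^ 2 - 1) ^ 2 + t * x * a ^ 2) / (t * a ^ 2) := by
          field_simp
          ring
        have : 0 ≤ ((t * x * a ^ 2 - 1) ^ 2 + t * x * a ^ 2) / (t * a ^ 2) := by positivity
        linarith
    · rw [(s2.mul_left t).tsum_add (hS.mul_left (1 / t)), tsum_mul_left, tsum_mul_left, ← hSdef]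
      have e : 2 + (p + 1) = p + 3 := by ring
      rw [e, ← ht] at t2
      calc _ ≤ t * (C2 / t) ^ 2 + 1 / t * S := by gcongr
        _ = (C2 ^ 2 + S) / t := by field_simp
        _ ≤ _ := by gcongr; linarith
  · have hB : 0 ≤ C1 / d ^ (2 + p) := by positivity
    have h := ennreal_tsum_le
      (f := fun n : ℤ => ((n.natAbs : ℝ≥0∞)) ^ (2 * p) * (‖binvhat z n‖₊ : ℝ≥0∞) ^ 2)
      (fun n => sq_nonneg _) s1 (fun n => by
        rw [coe_eq, mul_pow, ← pow_mul, mul_comm p 2]) t1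
    refine (ENNReal.rpow_le_rpow h (by norm_num)).trans ?_
    rw [ENNReal.ofReal_rpow_of_nonneg (sq_nonneg _) (by norm_num), ← Real.sqrt_eq_rpow,
      Real.sqrt_sq hB, add_comm 2 p]
    apply ENNReal.ofReal_le_ofReal
    gcongr
    nlinarith [sq_nonneg C2]
end
end

section
/- Let j ≥ 3 be an integer, a > 2, and define the real polynomial q(x) = x^{2j+1} − a x^{2j} − x^{2j−1} + a. Then q has exactly one root x_a in the open interval (1, ∞), and this root satisfies a < x_a < a + 1/a. -/
theorem aux_unique (n : ℕ) (a : ℝ) (ha : 2 < a) (x y : ℝ) (hx : 1 < x) (hxy : x < y)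
    (h1 : x ^ n * (x ^ 2 - a * x - 1) + a = 0)
    (h2 : y ^ n * (y ^ 2 - a * y - 1) + a = 0) : False := by
  have hc := convexOn_zpow (𝕜 := ℝ) (-(n : ℤ))
  have key : ∀ z : ℝ, 1 < z → z ^ n * (z ^ 2 - a * z - 1) + a = 0 →
      a * z ^ (-(n : ℤ)) = 1 + a * z - z ^ 2 := by
    intro z hz h
    have hp : z ^ n ≠ 0 := pow_ne_zero _ (by linarith)
    rw [zpow_neg, zpow_natCast]
    field_simp
    linarith
  have kx := key x hx h1
  have ky := key y (hx.trans hxy) h2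
  have hy : 0 < y - 1 := by linarith
  obtain ⟨s, hs⟩ : ∃ s, s = (x - 1) / (y - 1) := ⟨_, rfl⟩
  have hs0 : 0 < s := by rw [hs]; exact div_pos (by linarith) hy
  have hs1 : s < 1 := by rw [hs, div_lt_one hy]; linarith
  have hxe : x = (1 - s) + s * y := by
    have : s * (y - 1) = x - 1 := by rw [hs]; field_simp
    linarith
  have hh := hc.2 (show (1 : ℝ) ∈ Set.Ioi 0 by simp)
    (show y ∈ Set.Ioi 0 from by simp only [Set.mem_Ioi]; linarith)
    (show 0 ≤ 1 - s by linarith) hs0.le (by ring)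
  simp only [smul_eq_mul, mul_one, one_zpow] at hh
  rw [← hxe] at hh
  have h3 := mul_le_mul_of_nonneg_left hh (show 0 ≤ a by linarith)
  have h4 : a * (1 - s + s * y ^ (-(n : ℤ))) = a * (1 - s) + s * (a * y ^ (-(n : ℤ))) := by ring
  rw [h4, kx, ky] at h3
  have h5 : 0 < s * (1 - s) * (y - 1) ^ 2 := by
    have : 0 < 1 - s := by linarith
    positivity
  rw [hxe] at h3
  nlinarith

/-- for an integer `j ≥ 3` and `a > 2`, the polynomial
`q(x) = x^{2j+1} − a x^{2j} − x^{2j−1} + a` has exactly one root `x_a` in `(1, ∞)`,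
and `a < x_a < a + 1/a`. -/
theorem stmt_15 (j : ℕ) (hj : 3 ≤ j) (a : ℝ) (ha : 2 < a) :
    ∃ xa : ℝ, a < xa ∧ xa < a + 1 / a ∧
      ∀ x : ℝ, (1 < x ∧ x ^ (2 * j + 1) - a * x ^ (2 * j) - x ^ (2 * j - 1) + a = 0) ↔
        x = xa := by
  obtain ⟨n, hn, hn1⟩ : ∃ n, 2 * j = n + 1 ∧ 2 ≤ n := ⟨2 * j - 1, by omega, by omega⟩
  have e : ∀ x : ℝ, x ^ (2 * j + 1) - a * x ^ (2 * j) - x ^ (2 * j - 1) + a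
      = x ^ n * (x ^ 2 - a * x - 1) + a := by
    intro x
    rw [hn, Nat.add_sub_cancel]
    ring
  simp only [e]
  have ha0 : 0 < a := by linarith
  have hi : 0 < 1 / a := by positivity
  have hcont : ContinuousOn (fun x : ℝ => x ^ n * (x ^ 2 - a * x - 1) + a)
      (Set.Icc a (a + 1 / a)) := by fun_prop
  have hmem := intermediate_value_Ioo (by linarith) hcont
  have hlo : a ^ n * (a ^ 2 - a * a - 1) + a < 0 := by
    have : a ^ 1 < a ^ n := pow_lt_pow_right₀ (by linarith) (by omega)
    nlinarith
  have hhi : 0 < (a + 1 / a) ^ n * ((a + 1 / a) ^ 2 - a * (a + 1 / a) - 1) + a := by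
    have : (a + 1 / a) ^ 2 - a * (a + 1 / a) - 1 = (1 / a) ^ 2 := by
      field_simp
      ring
    rw [this]
    positivity
  obtain ⟨xa, ⟨hx1, hx2⟩, hx3⟩ := hmem (show (0 : ℝ) ∈ Set.Ioo _ _ from ⟨hlo, hhi⟩)
  refine ⟨xa, hx1, hx2, fun x => ⟨?_, ?_⟩⟩
  · rintro ⟨h1, h2⟩
    rcases lt_trichotomy x xa with h | h | h
    · exact (aux_unique n a ha x xa h1 h h2 hx3).elim
    · exact h
    · exact (aux_unique n a ha xa x (by linarith) h hx3 h2).elim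
  · rintro rfl
    exact ⟨by linarith, hx3⟩
end
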